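/- Fix μ₁ > μ₂ and variances σ₁², σ₂² > 0, and let N > 1 be a real number. Let X, Y be independent Gaussian with means μ₁, μ₂ and variances σ₁², σ₂², and let X'', Y'' be independent Gaussian with means μ₁, μ₂ and variances N·σ₁², N·σ₂². Then P(X'' > Y'') < P(X > Y); i.e., scaling both variances up by the factor N strictly decreases the probability of the larger-mean variable exceeding the smaller-mean one. -/

import Mathlib

open MeasureTheory ProbabilityTheory Real

/-- The upper tail of a Gaussian, expressed through the standard Gaussian. -/
theorem gaussianReal_Ioi_zero_eq_standard (d : ℝ) {v : NNReal} (hv : v ≠ 0) :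
    gaussianReal d v (Set.Ioi 0) = gaussianReal 0 1 (Set.Ioi (-d / √v)) := by
  have hs : 0 < √(v : ℝ) := Real.sqrt_pos.2 (by positivity)
  have hmap : gaussianReal d v = (gaussianReal 0 1).map (fun x ↦ √v * x + d) := by
    have hcomp : (fun x : ℝ ↦ √v * x + d) = (fun x ↦ x + d) ∘ (fun x ↦ √v * x) := rfl
    rw [hcomp, ← Measure.map_map (by fun_prop) (by fun_prop), gaussianReal_map_const_mul,
      gaussianReal_map_add_const]
    congr 1
    · simp
    · ext
      simp
  rw [hmap, Measure.map_apply (by fun_prop) measurableSet_Ioi]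
  congr 1
  ext x
  simp only [Set.mem_preimage, Set.mem_Ioi, div_lt_iff₀ hs]
  constructor <;> intro h <;> linarith

/-- Nondegenerate Gaussian measures have strictly decreasing upper tails. -/
theorem gaussianReal_Ioi_strictAnti (m : ℝ) {v : NNReal} (hv : v ≠ 0) :
    StrictAnti fun a ↦ gaussianReal m v (Set.Ioi a) := by
  intro a b hab
  have hpos : gaussianReal m v (Set.Ioc a b) ≠ 0 := fun h ↦ by
    have := gaussianReal_absolutelyContinuous' m hv h
    simp [Real.volume_Ioc, hab.not_ge] at this
  have hunion : gaussianReal m v (Set.Ioi a) =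
      gaussianReal m v (Set.Ioc a b) + gaussianReal m v (Set.Ioi b) := by
    rw [← Set.Ioc_union_Ioi_eq_Ioi hab.le]
    exact measure_union (Set.Ioc_disjoint_Ioi le_rfl) measurableSet_Ioi
  simp only [hunion]
  rw [add_comm]
  exact ENNReal.lt_add_right (measure_ne_top _ _) hpos

/-- A Gaussian with positive mean is less likely to be positive when its variance is larger. -/
theorem gaussianReal_Ioi_zero_lt_of_var_lt {d : ℝ} (hd : 0 < d) {v w : NNReal} (hv : v ≠ 0)
    (hvw : v < w) : gaussianReal d w (Set.Ioi 0) < gaussianReal d v (Set.Ioi 0) := by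
  rw [gaussianReal_Ioi_zero_eq_standard d hv,
    gaussianReal_Ioi_zero_eq_standard d (hvw.bot_lt.ne')]
  apply gaussianReal_Ioi_strictAnti 0 one_ne_zero
  have hs : 0 < √(v : ℝ) := Real.sqrt_pos.2 (by positivity)
  rw [neg_div, neg_div, neg_lt_neg_iff]
  exact div_lt_div_of_pos_left hd hs (Real.sqrt_lt_sqrt v.coe_nonneg (by exact_mod_cast hvw))

/-- The probability that one of two independent Gaussians exceeds the other. -/
theorem measure_lt_of_indepFun_gaussianReal {Ω : Type*} {mΩ : MeasurableSpace Ω} {P : Measure Ω}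
    {X Y : Ω → ℝ} (hXm : Measurable X) (hYm : Measurable Y) (hXY : IndepFun X Y P)
    {m₁ m₂ : ℝ} {v₁ v₂ : NNReal} (hX : P.map X = gaussianReal m₁ v₁)
    (hY : P.map Y = gaussianReal m₂ v₂) :
    P {ω | X ω > Y ω} = gaussianReal (m₁ - m₂) (v₁ + v₂) (Set.Ioi 0) := by
  have hneg : P.map (-Y) = gaussianReal (-m₂) v₂ := by
    rw [← gaussianReal_map_neg, ← hY, Measure.map_map measurable_neg hYm]
    rfl
  have hindep : IndepFun X (-Y) P := hXY.comp measurable_id measurable_neg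
  rw [sub_eq_add_neg, ← gaussianReal_add_gaussianReal_of_indepFun hindep hX hneg,
    Measure.map_apply (hXm.add hYm.neg) measurableSet_Ioi]
  congr 1
  ext ω
  simp

/-- Combiner C2 increases exploration: with `μ₁ > μ₂`, scaling both variances up by a factor
`N > 1` strictly decreases the probability that the larger-mean Gaussian exceeds the
smaller-mean one: `P(X'' > Y'') < P(X > Y)`. -/
theorem variance_inflate_decreases_prob_optimal
    {Ω : Type*} [MeasureSpace Ω] [IsProbabilityMeasure (ℙ : Measure Ω)]
    (μ₁ μ₂ σ₁ σ₂ N : ℝ) (hμ : μ₁ > μ₂) (hσ₁ : 0 < σ₁) (hσ₂ : 0 < σ₂) (hN : 1 < N)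
    (X Y X'' Y'' : Ω → ℝ)
    (hXmeas : Measurable X) (hYmeas : Measurable Y)
    (hX''meas : Measurable X'') (hY''meas : Measurable Y'')
    (hindep : IndepFun X Y ℙ) (hindep'' : IndepFun X'' Y'' ℙ)
    (hX : Measure.map X ℙ = gaussianReal μ₁ ⟨σ₁ ^ 2, sq_nonneg σ₁⟩)
    (hY : Measure.map Y ℙ = gaussianReal μ₂ ⟨σ₂ ^ 2, sq_nonneg σ₂⟩)
    (hX'' : Measure.map X'' ℙ =
      gaussianReal μ₁ ⟨N * σ₁ ^ 2, mul_nonneg (by linarith) (sq_nonneg σ₁)⟩)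
    (hY'' : Measure.map Y'' ℙ =
      gaussianReal μ₂ ⟨N * σ₂ ^ 2, mul_nonneg (by linarith) (sq_nonneg σ₂)⟩) :
    ℙ {ω | X'' ω > Y'' ω} < ℙ {ω | X ω > Y ω} := by
  rw [measure_lt_of_indepFun_gaussianReal hXmeas hYmeas hindep hX hY,
    measure_lt_of_indepFun_gaussianReal hX''meas hY''meas hindep'' hX'' hY'']
  refine gaussianReal_Ioi_zero_lt_of_var_lt (sub_pos.2 hμ) ?_ ?_
  · refine ne_of_gt (NNReal.coe_lt_coe.1 ?_)
    change 0 < σ₁ ^ 2 + σ₂ ^ 2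
    positivity
  · refine NNReal.coe_lt_coe.1 ?_
    change σ₁ ^ 2 + σ₂ ^ 2 < N * σ₁ ^ 2 + N * σ₂ ^ 2
    nlinarith [pow_pos hσ₁ 2, pow_pos hσ₂ 2]
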